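/- There exist τ-structures M1 and M2 in the vocabulary τ (consisting of two unary predicate symbols P1 and P2, two binary relation symbols R1 and R2, and one binary function symbol F) and an elementary embedding of M1 into M2, such that the ultrafilter extensions β(M1) and β(M2) are NOT elementarily equivalent; i.e., there is a first-order τ-sentence ψ with β(M1) ⊨ ψ and β(M2) ⊨ ¬ψ. (Main Theorem: ultrafilter extensions do not preserve elementary equivalence, nor elementary embeddings.) -/

import Mathlib

open FirstOrder Language

/-- Iterated ultrafilter quantifier. -/
def extProp {M : Type*} : ∀ {n : ℕ}, (Fin n → Ultrafilter M) → ((Fin n → M) → Prop) → Prop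
  | 0, _, φ => φ Fin.elim0
  | _ + 1, D, φ =>
      {a : M | extProp (fun i => D i.succ) (fun x => φ (Fin.cons a x))} ∈ D 0

/-- Ultrafilter extension of an `n`-ary function. -/
def extFun {M : Type*} : ∀ {n : ℕ}, (Fin n → Ultrafilter M) → ((Fin n → M) → M) → Ultrafilter M
  | 0, _, f => pure (f Fin.elim0)
  | _ + 1, D, f =>
      (D 0).bind fun a => extFun (fun i => D i.succ) (fun x => f (Fin.cons a x))

/-- The ultrafilter extension `β(M)` of an `L`-structure `M`. -/
noncomputable def ultrafilterStructure (L : Language) (M : Type*) [L.Structure M] :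
    L.Structure (Ultrafilter M) where
  funMap f D := extFun D fun x => Structure.funMap f x
  RelMap r D := extProp D fun x => Structure.RelMap r x

/-- The vocabulary `τ`: two unary predicate symbols `P1, P2`, two binary relation
symbols `R1, R2`, and one binary function symbol `F`. -/
def tau : Language :=
  ⟨fun n => match n with
    | 2 => Unit
    | _ => Empty,
   fun n => match n with
    | 1 => Fin 2
    | 2 => Fin 2
    | _ => Empty⟩

/-- The `τ`-structure on `ℕ` in which both binary relation symbols are interpreted as `<`. -/
@[reducible] def natOrderStructure : tau.Structure ℕ where
  funMap {n} f x := match n, f, x with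
    | 2, _, x => x 0
  RelMap {n} r x := match n, r, x with
    | 1, _, _ => False
    | 2, _, x => x 0 < x 1

/-- The relation symbol `R1`. -/
def tauLT : tau.Relations 2 := (0 : Fin 2)

/-- Two irreflexive, mutually incomparable points are equal. -/
def incomparableEqSentence : tau.Sentence :=
  ∀' ∀' (∼(tauLT.boundedFormula₂ (&0) (&0)) ⟹ ∼(tauLT.boundedFormula₂ (&1) (&1)) ⟹
    ∼(tauLT.boundedFormula₂ (&0) (&1)) ⟹ ∼(tauLT.boundedFormula₂ (&1) (&0)) ⟹
    (&0) =' (&1))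

theorem realize_incomparableEqSentence {M : Type*} [tau.Structure M] :
    M ⊨ incomparableEqSentence ↔ ∀ x y : M, ¬ Structure.RelMap tauLT ![x, x] →
      ¬ Structure.RelMap tauLT ![y, y] → ¬ Structure.RelMap tauLT ![x, y] →
      ¬ Structure.RelMap tauLT ![y, x] → x = y := by
  simp [incomparableEqSentence, Sentence.Realize, Formula.Realize, BoundedFormula.realize_rel₂,
    Fin.snoc]

theorem relMap_ultrafilterStructure₂ {L : Language} {M : Type*} [L.Structure M]
    (r : L.Relations 2) (x y : Ultrafilter M) :
    (ultrafilterStructure L M).RelMap r ![x, y] ↔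
      ∀ᶠ a in (x : Filter M), ∀ᶠ b in (y : Filter M), Structure.RelMap r ![a, b] :=
  Iff.rfl

/-- The diagonal elementary embedding of a structure into an ultrapower. -/
def ultrapowerDiag {L : Language} {α M : Type*} (u : Ultrafilter α) [L.Structure M] [Nonempty M] :
    M ↪ₑ[L] (u : Filter α).Product fun _ => M where
  toFun m := ((fun _ => m : α → M) : (u : Filter α).Product fun _ => M)
  map_formula' _ φ x :=
    (Ultraproduct.realize_formula_cast (u := u) (M := fun _ : α => M) φ (fun i _ => x i)).trans
      Filter.eventually_const

theorem realize_ultrafilterStructure_nat :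
    @Sentence.Realize tau (Ultrafilter ℕ) (@ultrafilterStructure tau ℕ natOrderStructure)
      incomparableEqSentence := by
  let _ := natOrderStructure
  let _ := ultrafilterStructure tau ℕ
  have key (x : Ultrafilter ℕ) (h : ¬ Structure.RelMap tauLT ![x, x]) : ∃ a, x = pure a := by
    by_contra! hx
    refine h ((relMap_ultrafilterStructure₂ tauLT x x).2 (.of_forall fun a => ?_))
    have hfin : (Set.Iic a)ᶜ ∈ x := by
      rw [Ultrafilter.compl_mem_iff_notMem]
      intro hm
      obtain ⟨b, -, hb⟩ := Ultrafilter.eq_pure_of_finite_mem (Set.finite_Iic a) hm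
      exact hx b hb
    exact Filter.mem_of_superset hfin fun b hb => Set.notMem_Iic.1 hb
  rw [realize_incomparableEqSentence]
  intro x y hx hy hxy hyx
  obtain ⟨a, rfl⟩ := key x hx
  obtain ⟨b, rfl⟩ := key y hy
  have hab : ¬ a < b := hxy
  have hba : ¬ b < a := hyx
  rw [le_antisymm (not_lt.1 hba) (not_lt.1 hab)]

/-- A sequence that is strictly descending for `R1` refutes the sentence in the ultrafilter
extension. -/
theorem not_realize_of_descending {M : Type*} [tau.Structure M] (e : ℕ → M)
    (hinj : Function.Injective e)
    (he : ∀ m n, n ≤ m → ¬ Structure.RelMap tauLT ![e n, e m]) :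
    ¬ @Sentence.Realize tau (Ultrafilter M) (ultrafilterStructure tau M)
      incomparableEqSentence := by
  let _ := ultrafilterStructure tau M
  rw [realize_incomparableEqSentence]
  intro h
  let x (i : ℕ) : Ultrafilter M := (Filter.hyperfilter ℕ).map fun n => e (2 * n + i)
  have hlt (i j : ℕ) : ¬ Structure.RelMap tauLT ![x i, x j] := by
    rw [relMap_ultrafilterStructure₂]
    intro H
    obtain ⟨n, hn⟩ := (Filter.eventually_map.1 H).exists
    have hcof : ∀ᶠ m in (Filter.hyperfilter ℕ : Filter ℕ), n + i ≤ m :=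
      Nat.hyperfilter_le_atTop (Filter.eventually_ge_atTop (n + i))
    obtain ⟨m, hm, hm'⟩ := ((Filter.eventually_map.1 hn).and hcof).exists
    exact he _ _ (by omega) hm
  have hmem (i : ℕ) : Set.range (fun n => e (2 * n + i)) ∈ x i :=
    Filter.mem_map.2 (Filter.univ_mem' fun n => ⟨n, rfl⟩)
  have heq : x 0 = x 1 := h _ _ (hlt 0 0) (hlt 1 1) (hlt 0 1) (hlt 1 0)
  obtain ⟨_, ⟨m, rfl⟩, n, hn⟩ := Ultrafilter.nonempty_of_mem
    (Filter.inter_mem (hmem 1) (heq ▸ hmem 0))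
  have := hinj hn
  omega

/-- Main Theorem: there exist `τ`-structures `M1`, `M2` and an elementary embedding of
`M1` into `M2` such that the ultrafilter extensions `β(M1)` and `β(M2)` are not
elementarily equivalent: some `τ`-sentence `ψ` holds in `β(M1)` but fails in `β(M2)`. -/
theorem ultrafilter_extensions_do_not_preserve_elementary_equivalence :
    ∃ (M1 M2 : Type) (S1 : tau.Structure M1) (S2 : tau.Structure M2),
      Nonempty (@Language.ElementaryEmbedding tau M1 M2 S1 S2) ∧
      ∃ ψ : tau.Sentence,
        (@Language.Sentence.Realize tau (Ultrafilter M1)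
          (@ultrafilterStructure tau M1 S1) ψ) ∧
        ¬ (@Language.Sentence.Realize tau (Ultrafilter M2)
          (@ultrafilterStructure tau M2 S2) ψ) := by
  let _ := natOrderStructure
  let u := Filter.hyperfilter ℕ
  let e (n : ℕ) : (u : Filter ℕ).Product fun _ => ℕ := (fun k => k - n : ℕ → ℕ)
  refine ⟨ℕ, (u : Filter ℕ).Product fun _ => ℕ, inferInstance, inferInstance,
    ⟨ultrapowerDiag u⟩, incomparableEqSentence, realize_ultrafilterStructure_nat,
    not_realize_of_descending e ?_ ?_⟩
  · intro m n h
    have hev : ∀ᶠ k in (u : Filter ℕ), k - m = k - n := Quotient.exact h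
    have hcof : ∀ᶠ k in (u : Filter ℕ), m + n ≤ k :=
      Nat.hyperfilter_le_atTop (Filter.eventually_ge_atTop (m + n))
    obtain ⟨k, hk, hk'⟩ := (hev.and hcof).exists
    omega
  · intro m n hmn h
    have hfun : (![e n, e m] : Fin 2 → (u : Filter ℕ).Product fun _ => ℕ) =
        fun i => ((![fun k => k - n, fun k => k - m] i : ℕ → ℕ) :
          (u : Filter ℕ).Product fun _ => ℕ) := by
      funext i
      fin_cases i <;> rfl
    rw [hfun] at h
    have hev : ∀ᶠ k in (u : Filter ℕ), k - n < k - m :=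
      (relMap_quotient_mk' ((u : Filter ℕ).productSetoid fun _ => ℕ) tauLT _).1 h
    obtain ⟨k, hk⟩ := hev.exists
    omega
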